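/- Let ρ : ℝ → ℝ be 2π-periodic, differentiable, with ρ(θ) > 0 for all θ and ρ' bounded. Then there is no sequence (x_n)_{n∈ℕ} of real numbers with 0 < x_{n+1} − x_n < π for all n, satisfying the dual billiards recursion L(x_{n−1}, x_n) = R(x_n, x_{n+1}) for all n ≥ 1, that converges to a finite limit. (Consequently the dual billiards map on a convex curve whose radius of curvature is positive, differentiable, and has bounded derivative has no crash orbits, i.e., no orbits converging to a single point of the curve.) -/

import Mathlib

open Real

noncomputable def Rfun (ρ : ℝ → ℝ) (θ θ' : ℝ) : ℝ :=
  (∫ η in θ..θ', Real.sin (θ' - η) * ρ η) / Real.sin (θ' - θ)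

noncomputable def Lfun (ρ : ℝ → ℝ) (θ θ' : ℝ) : ℝ :=
  (∫ η in θ..θ', Real.sin (η - θ) * ρ η) / Real.sin (θ' - θ)

theorem abs_one_sub_cos_sub_half_mul_sin_le {d : ℝ} (hd : 0 < d) (hd1 : d ≤ 1) :
    |1 - Real.cos d - d / 2 * Real.sin d| ≤ d ^ 3 := by
  have hcos := abs_le.1 (Real.cos_bound (x := d) (by rwa [abs_of_pos hd]))
  rw [abs_of_pos hd] at hcos
  have hsin := Real.sin_lt hd
  have hsin' := Real.sin_gt_sub_cube hd
  have h4 : d ^ 4 ≤ d ^ 3 := pow_le_pow_of_le_one hd.le hd1 (by norm_num)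
  have h3 : 0 < d ^ 3 := by positivity
  rw [abs_le]
  constructor <;> nlinarith [mul_pos hd (sub_pos.2 hsin), mul_pos hd (sub_pos.2 hsin')]

/-- For small gaps, `Rfun ρ θ θ'` is `ρ θ * (θ' - θ) / 2` up to a quadratic error. -/
theorem abs_Rfun_sub_le {ρ : ℝ → ℝ} {M θ θ' : ℝ} (hc : Continuous ρ)
    (hlip : ∀ s t, |ρ s - ρ t| ≤ M * |s - t|) (hθ : 0 ≤ ρ θ)
    (hlt : 0 < θ' - θ) (hle : θ' - θ ≤ 1) :
    |Rfun ρ θ θ' - ρ θ * ((θ' - θ) / 2)| ≤ 2 * (M + ρ θ) * (θ' - θ) ^ 2 := by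
  have hM : 0 ≤ M := by simpa using (abs_nonneg _).trans (hlip 1 0)
  have hmain : ∫ η in θ..θ', Real.sin (θ' - η) = 1 - Real.cos (θ' - θ) := by
    rw [intervalIntegral.integral_comp_sub_left (fun u => Real.sin u) θ']
    simp
  have hsplit : ∫ η in θ..θ', Real.sin (θ' - η) * ρ η =
      (∫ η in θ..θ', Real.sin (θ' - η) * (ρ η - ρ θ)) + (1 - Real.cos (θ' - θ)) * ρ θ := by
    rw [← hmain, ← intervalIntegral.integral_mul_const, ← intervalIntegral.integral_add]
    · congr 1
      ext η
      ring
    · exact Continuous.intervalIntegrable (by fun_prop) _ _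
    · exact Continuous.intervalIntegrable (by fun_prop) _ _
  have herr : |∫ η in θ..θ', Real.sin (θ' - η) * (ρ η - ρ θ)| ≤ M * (θ' - θ) ^ 3 := by
    have h := intervalIntegral.norm_integral_le_of_norm_le_const
      (a := θ) (b := θ') (C := (θ' - θ) * (M * (θ' - θ)))
      (f := fun η => Real.sin (θ' - η) * (ρ η - ρ θ)) (fun η hη => by
        rw [Set.uIoc_of_le (by linarith)] at hη
        rw [norm_mul, Real.norm_eq_abs, Real.norm_eq_abs]
        have h1 : |Real.sin (θ' - η)| ≤ θ' - θ := by
          refine Real.abs_sin_le_abs.trans ?_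
          rw [abs_of_nonneg (by linarith [hη.2])]
          linarith [hη.1]
        have h2 : |ρ η - ρ θ| ≤ M * (θ' - θ) := by
          refine (hlip η θ).trans (mul_le_mul_of_nonneg_left ?_ hM)
          rw [abs_of_pos (by linarith [hη.1])]
          linarith [hη.2]
        exact mul_le_mul h1 h2 (abs_nonneg _) hlt.le)
    rw [Real.norm_eq_abs, abs_of_pos hlt] at h
    exact h.trans_eq (by ring)
  have htrig := abs_one_sub_cos_sub_half_mul_sin_le hlt hle
  have hsin : (θ' - θ) / 2 ≤ Real.sin (θ' - θ) := by
    have := Real.sin_gt_sub_cube hlt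
    nlinarith [pow_le_pow_of_le_one hlt.le hle (show 1 ≤ 3 by norm_num)]
  unfold Rfun
  rw [hsplit]
  set d := θ' - θ
  set E := ∫ η in θ..θ', Real.sin (θ' - η) * (ρ η - ρ θ)
  have hs : 0 < Real.sin d := by linarith
  have heq : (E + (1 - Real.cos d) * ρ θ) / Real.sin d - ρ θ * (d / 2) =
      (E + (1 - Real.cos d - d / 2 * Real.sin d) * ρ θ) / Real.sin d := by
    field_simp
    ring
  rw [heq, abs_div, abs_of_pos hs, div_le_iff₀ hs]
  calc |E + (1 - Real.cos d - d / 2 * Real.sin d) * ρ θ|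
      ≤ M * d ^ 3 + d ^ 3 * ρ θ := by
        refine (abs_add_le _ _).trans (add_le_add herr ?_)
        rw [abs_mul, abs_of_nonneg hθ]
        exact mul_le_mul_of_nonneg_right htrig hθ
    _ = 2 * (M + ρ θ) * d ^ 2 * (d / 2) := by ring
    _ ≤ 2 * (M + ρ θ) * d ^ 2 * Real.sin d :=
        mul_le_mul_of_nonneg_left hsin (by positivity)

theorem Lfun_eq_Rfun_neg (ρ : ℝ → ℝ) (θ θ' : ℝ) :
    Lfun ρ θ θ' = Rfun (fun t => ρ (-t)) (-θ') (-θ) := by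
  have h := intervalIntegral.integral_comp_neg (a := -θ') (b := -θ)
    (fun η => Real.sin (η - θ) * ρ η)
  simp only [neg_neg] at h
  unfold Lfun Rfun
  rw [← h]
  congr 2
  · ext η
    ring_nf
  · ring

theorem abs_Lfun_sub_le {ρ : ℝ → ℝ} {M θ θ' : ℝ} (hc : Continuous ρ)
    (hlip : ∀ s t, |ρ s - ρ t| ≤ M * |s - t|) (hθ : 0 ≤ ρ θ')
    (hlt : 0 < θ' - θ) (hle : θ' - θ ≤ 1) :
    |Lfun ρ θ θ' - ρ θ' * ((θ' - θ) / 2)| ≤ 2 * (M + ρ θ') * (θ' - θ) ^ 2 := by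
  have h := abs_Rfun_sub_le (ρ := fun t => ρ (-t)) (M := M) (θ := -θ') (θ' := -θ)
    (hc.comp continuous_neg)
    (fun s t => (hlip _ _).trans_eq (by rw [← abs_neg (s - t)]; congr 2; ring))
    (by simpa using hθ) (by linarith) (by linarith)
  rw [Lfun_eq_Rfun_neg]
  simpa [sub_eq_add_neg, add_comm] using h

theorem inv_le_inv_add_of_abs_sub_le {a b C : ℝ} (ha : 0 < a) (hb : 0 < b) (hC : 0 < C)
    (h : |a - b| ≤ C * (a ^ 2 + b ^ 2)) (hsmall : 4 * C * a ≤ 1) :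
    b⁻¹ ≤ a⁻¹ + 4 * C := by
  rcases le_total a b with hab | hab
  · have := inv_anti₀ ha hab
    linarith
  · have hsub : a - b ≤ 2 * C * a ^ 2 := by
      nlinarith [le_abs_self (a - b), mul_le_mul_of_nonneg_left (pow_le_pow_left₀ hb.le hab 2) hC.le]
    have hhalf : a ≤ 2 * b := by nlinarith
    have hkey : a ≤ b + 4 * C * (a * b) := by nlinarith [mul_pos hC ha]
    have heq : a⁻¹ + 4 * C = (b + 4 * C * (a * b)) / (a * b) := by field_simp
    have heq' : b⁻¹ = a / (a * b) := by field_simp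
    rw [heq, heq']
    gcongr

theorem not_summable_of_inv_succ_le_add {d : ℕ → ℝ} {K : ℝ} (hd : ∀ n, 0 < d n)
    (h : ∀ n, (d (n + 1))⁻¹ ≤ (d n)⁻¹ + K) : ¬ Summable d := by
  intro hs
  set B := max K (d 0)⁻¹
  have hB : 0 < B := lt_max_of_lt_right (inv_pos.2 (hd 0))
  have hle : ∀ n : ℕ, (d n)⁻¹ ≤ B * ((n + 1 : ℕ) : ℝ) := by
    intro n
    induction n with
    | zero => simp [B]
    | succ n ih =>
      have hK : K ≤ B := le_max_left _ _
      push_cast at ih ⊢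
      linarith [h n]
  have hs' : Summable fun n : ℕ => (((n + 1 : ℕ) : ℝ))⁻¹ := by
    refine Summable.of_nonneg_of_le (fun n => by positivity) (fun n => ?_) (hs.mul_left B)
    have h1 : (0 : ℝ) < ((n + 1 : ℕ) : ℝ) := by positivity
    rw [inv_le_iff_one_le_mul₀ h1]
    have h2 := mul_le_mul_of_nonneg_right (hle n) (hd n).le
    rw [inv_mul_cancel₀ (hd n).ne'] at h2
    linarith
  exact Real.not_summable_natCast_inv
    ((summable_nat_add_iff (f := fun n : ℕ => ((n : ℝ))⁻¹) 1).1 hs')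

theorem stmt18 (ρ : ℝ → ℝ)
    (hper : Function.Periodic ρ (2 * π))
    (hdiff : Differentiable ℝ ρ)
    (hpos : ∀ t : ℝ, 0 < ρ t)
    (hbd : ∃ M : ℝ, ∀ t : ℝ, |deriv ρ t| ≤ M) :
    ¬ ∃ x : ℕ → ℝ,
        (∀ n : ℕ, 0 < x (n + 1) - x n ∧ x (n + 1) - x n < π) ∧
        (∀ n : ℕ, 1 ≤ n → Lfun ρ (x (n - 1)) (x n) = Rfun ρ (x n) (x (n + 1))) ∧
        ∃ c : ℝ, Filter.Tendsto x Filter.atTop (nhds c) := by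
  obtain ⟨M, hM⟩ := hbd
  have hM0 : 0 ≤ M := (abs_nonneg _).trans (hM 0)
  have hc := hdiff.continuous
  have hlip : ∀ s t, |ρ s - ρ t| ≤ M * |s - t| := fun s t =>
    Convex.norm_image_sub_le_of_norm_deriv_le (s := Set.univ) (fun y _ => hdiff y)
      (fun y _ => hM y) convex_univ (Set.mem_univ t) (Set.mem_univ s)
  rintro ⟨x, hx, hrec, c, hlim⟩
  set m := ρ c / 2
  have hm : 0 < m := half_pos (hpos c)
  set C := 4 * (M / m + 1)
  have hC : 0 < C := by positivity
  have hgap : Filter.Tendsto (fun n => x (n + 1) - x n) Filter.atTop (nhds 0) := by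
    simpa using ((Filter.tendsto_add_atTop_iff_nat 1).2 hlim).sub hlim
  have hev_m : ∀ᶠ n in Filter.atTop, m < ρ (x n) :=
    ((hc.tendsto c).comp hlim).eventually_const_lt (half_lt_self (hpos c))
  have hev_gap : ∀ᶠ n in Filter.atTop, x (n + 1) - x n < min 1 (1 / (4 * C)) :=
    hgap.eventually_lt_const (by positivity)
  obtain ⟨N, hN⟩ := Filter.eventually_atTop.1 (hev_m.and hev_gap)
  refine not_summable_of_inv_succ_le_add (d := fun k => x (N + k + 1) - x (N + k))
    (K := 4 * C) (fun k => (hx _).1) (fun k => ?_) ?_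
  · have ha := (hx (N + k)).1
    have hb := (hx (N + k + 1)).1
    have ha' := (hN (N + k) (by omega)).2
    have hb' := (hN (N + k + 1) (by omega)).2
    have hr := (hN (N + k + 1) (by omega)).1
    rw [lt_min_iff] at ha' hb'
    have hL := abs_Lfun_sub_le hc hlip (hpos _).le ha ha'.1.le
    have hR := abs_Rfun_sub_le hc hlip (hpos _).le hb hb'.1.le
    have heq := hrec (N + k + 1) (by omega)
    rw [Nat.add_sub_cancel] at heq
    rw [heq] at hL
    refine inv_le_inv_add_of_abs_sub_le ha hb hC ?_ ?_
    · set a := x (N + k + 1) - x (N + k)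
      set b := x (N + k + 1 + 1) - x (N + k + 1)
      set r := ρ (x (N + k + 1))
      have hr0 : 0 < r := hpos _
      have hMr : M + r ≤ r * (M / m + 1) := by
        have : M ≤ r * (M / m) := by
          rw [mul_div_assoc', le_div_iff₀ hm]
          nlinarith
        linarith
      have hmul : r * |a - b| ≤ r * (C * (a ^ 2 + b ^ 2)) := by
        calc r * |a - b| = 2 * |r * (a / 2) - r * (b / 2)| := by
              rw [← mul_sub, abs_mul, abs_of_pos hr0, ← sub_div, abs_div, abs_two]
              ring
          _ ≤ 4 * (M + r) * (a ^ 2 + b ^ 2) := by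
              have := abs_sub_le (r * (a / 2)) (Rfun ρ (x (N + k + 1)) (x (N + k + 1 + 1)))
                (r * (b / 2))
              rw [abs_sub_comm] at hL
              linarith
          _ ≤ 4 * (r * (M / m + 1)) * (a ^ 2 + b ^ 2) := by gcongr
          _ = r * (C * (a ^ 2 + b ^ 2)) := by ring
      exact le_of_mul_le_mul_left hmul hr0
    · have h := ha'.2.le
      rw [le_div_iff₀ (by positivity)] at h
      linarith
  · have hmono : Monotone x := monotone_nat_of_le_succ fun n => by linarith [(hx n).1]
    refine summable_of_sum_range_le (c := c - x N) (fun k => (hx _).1.le) (fun n => ?_)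
    have htel := Finset.sum_range_sub (fun k => x (N + k)) n
    simp only [← add_assoc, add_zero] at htel
    rw [htel]
    linarith [hmono.ge_of_tendsto hlim (N + n)]
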